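/- Let the boundary-value problem L(ε)y = f(·,ε), B(ε)y = c(ε) satisfy Condition (0) and Limit Conditions (I) and (II), and let ε₁ be the number from condition (∗). Then there exist positive numbers ε₂ < ε₁, κ₁, and κ₂ such that for every ε ∈ (0, ε₂) the unique solutions y(·,0) and y(·,ε) satisfy the two-sided estimate κ₁ · d_{n,α}(ε) ≤ ‖y(·,0) − y(·,ε)‖_{n+r,α} ≤ κ₂ · d_{n,α}(ε), where d_{n,α}(ε) := ‖L(ε)y(·,0) − f(·,ε)‖_{n,α} + |B(ε)y(·,0) − c(ε)| is the discrepancy; the numbers ε₂, κ₁ and κ₂ do not depend on the functions y(·,0) and y(·,ε). -/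

import Mathlib

open Set Filter Topology

noncomputable section

/-- `x` belongs to the Hölder space `C^{n,α}([a,b],ℂ)`: it is `n` times continuously
differentiable on `[a,b]` and the Hölder seminorm of `x⁽ⁿ⁾` is finite. -/
def HolMem (a b : ℝ) (n : ℕ) (α : ℝ) (x : ℝ → ℂ) : Prop :=
  ContDiffOn ℝ n x (Set.Icc a b) ∧
    ∃ C : ℝ, ∀ t₁ ∈ Set.Icc a b, ∀ t₂ ∈ Set.Icc a b, t₁ < t₂ →
      ‖iteratedDerivWithin n x (Set.Icc a b) t₂ - iteratedDerivWithin n x (Set.Icc a b) t₁‖ ≤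
        C * (t₂ - t₁) ^ α

/-- The Hölder seminorm `‖x‖'_{n,α}`. -/
def holSemiNorm (a b : ℝ) (n : ℕ) (α : ℝ) (x : ℝ → ℂ) : ℝ :=
  sSup { s : ℝ | ∃ t₁ ∈ Set.Icc a b, ∃ t₂ ∈ Set.Icc a b, t₁ < t₂ ∧
    s = ‖iteratedDerivWithin n x (Set.Icc a b) t₂ - iteratedDerivWithin n x (Set.Icc a b) t₁‖ /
        (t₂ - t₁) ^ α }

/-- The Hölder norm `‖x‖_{n,α} = ∑_{j=0}^n max_{[a,b]} |x⁽ʲ⁾| + ‖x‖'_{n,α}`. -/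
def holNorm (a b : ℝ) (n : ℕ) (α : ℝ) (x : ℝ → ℂ) : ℝ :=
  (∑ j ∈ Finset.range (n + 1),
      sSup { s : ℝ | ∃ t ∈ Set.Icc a b, s = ‖iteratedDerivWithin j x (Set.Icc a b) t‖ }) +
    holSemiNorm a b n α x

/-- Vector-valued Hölder class `(C^{n,α})^k`. -/
def vHolMem (a b : ℝ) (n : ℕ) (α : ℝ) {k : ℕ} (x : ℝ → (Fin k → ℂ)) : Prop :=
  ∀ i, HolMem a b n α (fun t => x t i)

/-- Norm on `(C^{n,α})^k`: the sum of the norms of the entries. -/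
def vHolNorm (a b : ℝ) (n : ℕ) (α : ℝ) {k : ℕ} (x : ℝ → (Fin k → ℂ)) : ℝ :=
  ∑ i, holNorm a b n α (fun t => x t i)

/-- Matrix-valued Hölder class `(C^{n,α})^{k×l}`. -/
def mHolMem (a b : ℝ) (n : ℕ) (α : ℝ) {k l : ℕ} (X : ℝ → Matrix (Fin k) (Fin l) ℂ) : Prop :=
  ∀ i j, HolMem a b n α (fun t => X t i j)

/-- Norm on `(C^{n,α})^{k×l}`: the sum of the norms of the entries. -/
def mHolNorm (a b : ℝ) (n : ℕ) (α : ℝ) {k l : ℕ} (X : ℝ → Matrix (Fin k) (Fin l) ℂ) : ℝ :=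
  ∑ i, ∑ j, holNorm a b n α (fun t => X t i j)

/-- Entrywise `p`-th derivative of a vector-valued function on `[a,b]`. -/
def vDeriv (a b : ℝ) (p : ℕ) {k : ℕ} (y : ℝ → (Fin k → ℂ)) : ℝ → (Fin k → ℂ) :=
  fun t i => iteratedDerivWithin p (fun s => y s i) (Set.Icc a b) t

/-- Entrywise `p`-th derivative of a matrix-valued function on `[a,b]`. -/
def mDeriv (a b : ℝ) (p : ℕ) {k l : ℕ} (Y : ℝ → Matrix (Fin k) (Fin l) ℂ) :
    ℝ → Matrix (Fin k) (Fin l) ℂ :=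
  fun t i j => iteratedDerivWithin p (fun s => Y s i j) (Set.Icc a b) t

/-- The differential expression `(L y)(t) = y⁽ʳ⁾(t) + ∑_{j=1}^r A_{r-j}(t) y⁽ʳ⁻ʲ⁾(t)`;
here `A j` denotes the coefficient matrix of `y⁽ʲ⁾`, for `0 ≤ j ≤ r-1`. -/
def Lop (a b : ℝ) (r : ℕ) {m : ℕ} (A : Fin r → ℝ → Matrix (Fin m) (Fin m) ℂ)
    (y : ℝ → (Fin m → ℂ)) : ℝ → (Fin m → ℂ) :=
  fun t => vDeriv a b r y t + ∑ j : Fin r, (A j t).mulVec (vDeriv a b (j : ℕ) y t)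

/-- The matrix analogue of `Lop`, applied to matrix-valued functions. -/
def LopM (a b : ℝ) (r : ℕ) {m k : ℕ} (A : Fin r → ℝ → Matrix (Fin m) (Fin m) ℂ)
    (Z : ℝ → Matrix (Fin m) (Fin k) ℂ) : ℝ → Matrix (Fin m) (Fin k) ℂ :=
  fun t => mDeriv a b r Z t + ∑ j : Fin r, A j t * mDeriv a b (j : ℕ) Z t

/-- `y` is a solution in `(C^{n+r,α})^m` of the problem `L y = f` on `[a,b]`, `B y = c`. -/
def IsSol (a b : ℝ) (n : ℕ) (α : ℝ) (r m : ℕ)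
    (A : Fin r → ℝ → Matrix (Fin m) (Fin m) ℂ)
    (B : (ℝ → (Fin m → ℂ)) →ₗ[ℂ] (Fin (r * m) → ℂ))
    (f : ℝ → (Fin m → ℂ)) (c : Fin (r * m) → ℂ) (y : ℝ → (Fin m → ℂ)) : Prop :=
  vHolMem a b (n + r) α y ∧ (∀ t ∈ Set.Icc a b, Lop a b r A y t = f t) ∧ B y = c

/-- Limit Condition (I): `A_{r-j}(·,ε) → A_{r-j}(·,0)` in `(C^{n,α})^{m×m}` as `ε → 0+`. -/
def CondI (a b : ℝ) (n : ℕ) (α : ℝ) (r m : ℕ)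
    (A : ℝ → Fin r → ℝ → Matrix (Fin m) (Fin m) ℂ) : Prop :=
  ∀ j : Fin r,
    Tendsto (fun ε => mHolNorm a b n α (fun t => A ε j t - A 0 j t))
      (nhdsWithin 0 (Set.Ioi 0)) (nhds 0)

/-- Limit Condition (II): `B(ε)y → B(0)y` in `ℂ^{rm}` as `ε → 0+`,
for every `y ∈ (C^{n+r,α})^m`. -/
def CondII (a b : ℝ) (n : ℕ) (α : ℝ) (r m : ℕ)
    (B : ℝ → (ℝ → (Fin m → ℂ)) →ₗ[ℂ] (Fin (r * m) → ℂ)) : Prop :=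
  ∀ y : ℝ → (Fin m → ℂ), vHolMem a b (n + r) α y →
    Tendsto (fun ε => B ε y) (nhdsWithin 0 (Set.Ioi 0)) (nhds (B 0 y))

/-- Condition (0): the homogeneous problem `L(0)y = 0`, `B(0)y = 0` has only the
trivial solution in `(C^{n+r,α})^m`. -/
def Cond0 (a b : ℝ) (n : ℕ) (α : ℝ) (r m : ℕ)
    (A : Fin r → ℝ → Matrix (Fin m) (Fin m) ℂ)
    (B : (ℝ → (Fin m → ℂ)) →ₗ[ℂ] (Fin (r * m) → ℂ)) : Prop :=
  ∀ y : ℝ → (Fin m → ℂ), vHolMem a b (n + r) α y →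
    (∀ t ∈ Set.Icc a b, Lop a b r A y t = 0) → B y = 0 →
    ∀ t ∈ Set.Icc a b, y t = 0

/-- Condition (∗): for every `ε ∈ [0,ε₁)` and arbitrary data `f ∈ (C^{n,α})^m`, `c ∈ ℂ^{rm}`,
the problem `L(ε)y = f`, `B(ε)y = c` has a unique solution `y ∈ (C^{n+r,α})^m`
(uniqueness is understood as equality on `[a,b]`). -/
def CondStar (a b : ℝ) (n : ℕ) (α : ℝ) (r m : ℕ) (ε₁ : ℝ)
    (A : ℝ → Fin r → ℝ → Matrix (Fin m) (Fin m) ℂ)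
    (B : ℝ → (ℝ → (Fin m → ℂ)) →ₗ[ℂ] (Fin (r * m) → ℂ)) : Prop :=
  ∀ ε ∈ Set.Ico (0 : ℝ) ε₁, ∀ f : ℝ → (Fin m → ℂ), vHolMem a b n α f →
    ∀ c : Fin (r * m) → ℂ,
      ∃ y, IsSol a b n α r m (A ε) (B ε) f c y ∧
        ∀ y', IsSol a b n α r m (A ε) (B ε) f c y' → Set.EqOn y' y (Set.Icc a b)

/-- Condition (∗∗): if `f(·,ε) → f(·,0)` in `(C^{n,α})^m` and `c(ε) → c(0)` in `ℂ^{rm}`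
as `ε → 0+`, then the solutions satisfy `y(·,ε) → y(·,0)` in `(C^{n+r,α})^m`. -/
def CondStarStar (a b : ℝ) (n : ℕ) (α : ℝ) (r m : ℕ) (ε₁ : ℝ)
    (A : ℝ → Fin r → ℝ → Matrix (Fin m) (Fin m) ℂ)
    (B : ℝ → (ℝ → (Fin m → ℂ)) →ₗ[ℂ] (Fin (r * m) → ℂ)) : Prop :=
  ∀ (f : ℝ → ℝ → (Fin m → ℂ)) (c : ℝ → Fin (r * m) → ℂ) (y : ℝ → ℝ → (Fin m → ℂ)),
    (∀ ε ∈ Set.Ico (0 : ℝ) ε₁, vHolMem a b n α (f ε) ∧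
      IsSol a b n α r m (A ε) (B ε) (f ε) (c ε) (y ε)) →
    Tendsto (fun ε => vHolNorm a b n α (fun t => f ε t - f 0 t))
      (nhdsWithin 0 (Set.Ioi 0)) (nhds 0) →
    Tendsto c (nhdsWithin 0 (Set.Ioi 0)) (nhds (c 0)) →
    Tendsto (fun ε => vHolNorm a b (n + r) α (fun t => y ε t - y 0 t))
      (nhdsWithin 0 (Set.Ioi 0)) (nhds 0)


/-! ### Scalar Hölder functions -/

def supN (a b : ℝ) (x : ℝ → ℂ) : ℝ := sSup { s : ℝ | ∃ t ∈ Set.Icc a b, s = ‖x t‖ }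

lemma supN_nonneg (a b : ℝ) (x : ℝ → ℂ) : 0 ≤ supN a b x := by
  apply Real.sSup_nonneg
  rintro s ⟨t, -, rfl⟩
  exact norm_nonneg _

lemma supN_le {a b : ℝ} {x : ℝ → ℂ} {M : ℝ} (hM : 0 ≤ M) (h : ∀ t ∈ Set.Icc a b, ‖x t‖ ≤ M) :
    supN a b x ≤ M := by
  apply Real.sSup_le _ hM
  rintro s ⟨t, ht, rfl⟩
  exact h t ht

lemma le_supN {a b : ℝ} {x : ℝ → ℂ} (hx : ContinuousOn x (Set.Icc a b)) {t : ℝ}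
    (ht : t ∈ Set.Icc a b) : ‖x t‖ ≤ supN a b x := by
  obtain ⟨C, hC⟩ := isCompact_Icc.exists_bound_of_continuousOn hx
  apply le_csSup
  · refine ⟨C, ?_⟩
    rintro s ⟨t, ht, rfl⟩
    exact hC t ht
  · exact ⟨t, ht, rfl⟩

lemma holSemi_nonneg (a b : ℝ) (n : ℕ) (α : ℝ) (x : ℝ → ℂ) : 0 ≤ holSemiNorm a b n α x := by
  apply Real.sSup_nonneg
  rintro s ⟨t, -, u, -, h, rfl⟩
  have : 0 ≤ u - t := by linarith
  positivity

lemma holNorm_nonneg (a b : ℝ) (n : ℕ) (α : ℝ) (x : ℝ → ℂ) : 0 ≤ holNorm a b n α x := by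
  apply add_nonneg _ (holSemi_nonneg _ _ _ _ _)
  apply Finset.sum_nonneg
  intro j _
  exact supN_nonneg a b _

lemma holNorm_succ (a b : ℝ) (n : ℕ) (α : ℝ) (x : ℝ → ℂ) :
    holNorm a b (n + 1) α x = supN a b x + holNorm a b n α (derivWithin x (Set.Icc a b)) := by
  unfold holNorm holSemiNorm supN
  rw [Finset.sum_range_succ']
  simp only [iteratedDerivWithin_succ', iteratedDerivWithin_zero]
  ring

lemma holNorm_zero (a b : ℝ) (α : ℝ) (x : ℝ → ℂ) :
    holNorm a b 0 α x = supN a b x + holSemiNorm a b 0 α x := by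
  unfold holNorm supN
  simp

lemma holMem_succ {a b : ℝ} (hab : a < b) (n : ℕ) (α : ℝ) (x : ℝ → ℂ) :
    HolMem a b (n + 1) α x ↔ DifferentiableOn ℝ x (Set.Icc a b) ∧
      HolMem a b n α (derivWithin x (Set.Icc a b)) := by
  unfold HolMem
  simp only [iteratedDerivWithin_succ', Nat.cast_add, Nat.cast_one]
  rw [contDiffOn_succ_iff_derivWithin (uniqueDiffOn_Icc hab)]
  simp [and_assoc]

lemma HolMem.continuousOn {a b : ℝ} {n : ℕ} {α : ℝ} {x : ℝ → ℂ} (h : HolMem a b n α x) :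
    ContinuousOn x (Set.Icc a b) := h.1.continuousOn

lemma HolMem.congr {a b : ℝ} {n : ℕ} {α : ℝ} {x y : ℝ → ℂ} (h : HolMem a b n α x)
    (hxy : Set.EqOn y x (Set.Icc a b)) : HolMem a b n α y := by
  obtain ⟨h1, C, h2⟩ := h
  refine ⟨h1.congr hxy, C, ?_⟩
  intro t ht u hu htu
  rw [iteratedDerivWithin_congr hxy ht, iteratedDerivWithin_congr hxy hu]
  exact h2 t ht u hu htu

lemma holNorm_congr {a b : ℝ} {n : ℕ} {α : ℝ} {x y : ℝ → ℂ}
    (hxy : Set.EqOn x y (Set.Icc a b)) : holNorm a b n α x = holNorm a b n α y := by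
  unfold holNorm holSemiNorm
  congr 1
  · apply Finset.sum_congr rfl
    intro j _
    congr 1
    ext s
    apply exists_congr; intro t
    apply and_congr_right; intro ht
    rw [iteratedDerivWithin_congr hxy ht]
  · congr 1
    ext s
    apply exists_congr; intro t
    apply and_congr_right; intro ht
    apply exists_congr; intro u
    apply and_congr_right; intro hu
    rw [iteratedDerivWithin_congr hxy ht, iteratedDerivWithin_congr hxy hu]

/-- Introduction rule for order zero. -/
lemma hol_zero_intro {a b α : ℝ} (hα : 0 < α) {x : ℝ → ℂ} {M S : ℝ} (hM0 : 0 ≤ M) (hS0 : 0 ≤ S)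
    (hM : ∀ t ∈ Set.Icc a b, ‖x t‖ ≤ M)
    (hS : ∀ t ∈ Set.Icc a b, ∀ u ∈ Set.Icc a b, t < u → ‖x u - x t‖ ≤ S * (u - t) ^ α) :
    HolMem a b 0 α x ∧ holNorm a b 0 α x ≤ M + S := by
  have hS' : ∀ t ∈ Set.Icc a b, ∀ u ∈ Set.Icc a b, ‖x u - x t‖ ≤ S * |u - t| ^ α := by
    intro t ht u hu
    rcases lt_trichotomy t u with h | h | h
    · rw [abs_of_pos (by linarith)]; exact hS t ht u hu h
    · subst h; simp [Real.zero_rpow hα.ne']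
    · rw [norm_sub_rev, abs_sub_comm, abs_of_pos (by linarith)]; exact hS u hu t ht h
  have hc : ContinuousOn x (Set.Icc a b) := by
    intro t ht
    rw [ContinuousWithinAt, tendsto_iff_norm_sub_tendsto_zero]
    have hl : Tendsto (fun u => S * |u - t| ^ α) (𝓝[Set.Icc a b] t) (𝓝 0) := by
      have : Continuous (fun u : ℝ => S * |u - t| ^ α) := by
        apply continuous_const.mul
        apply Continuous.rpow_const (by fun_prop)
        intro _; right; exact hα.le
      have h2 := (this.tendsto t).mono_left (nhdsWithin_le_nhds (s := Set.Icc a b))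
      simpa [Real.zero_rpow hα.ne'] using h2
    refine squeeze_zero' (Eventually.of_forall fun _ => norm_nonneg _) ?_ hl
    filter_upwards [self_mem_nhdsWithin] with u hu
    exact hS' t ht u hu
  refine ⟨⟨by simpa using hc, S, by simpa using hS⟩, ?_⟩
  rw [holNorm_zero]
  apply add_le_add (supN_le hM0 hM)
  apply Real.sSup_le _ hS0
  rintro s ⟨t, ht, u, hu, htu, rfl⟩
  rw [iteratedDerivWithin_zero, div_le_iff₀ (Real.rpow_pos_of_pos (by linarith) _)]
  exact hS t ht u hu htu

lemma hol_zero_elim {a b α : ℝ} {x : ℝ → ℂ} (h : HolMem a b 0 α x) :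
    ∃ M S : ℝ, 0 ≤ M ∧ 0 ≤ S ∧ holNorm a b 0 α x = M + S ∧
    (∀ t ∈ Set.Icc a b, ‖x t‖ ≤ M) ∧
    (∀ t ∈ Set.Icc a b, ∀ u ∈ Set.Icc a b, t < u → ‖x u - x t‖ ≤ S * (u - t) ^ α) := by
  refine ⟨supN a b x, holSemiNorm a b 0 α x, supN_nonneg _ _ _, holSemi_nonneg _ _ _ _ _,
    holNorm_zero _ _ _ _, fun t ht => le_supN h.continuousOn ht, ?_⟩
  intro t ht u hu htu
  obtain ⟨h1, C, h2⟩ := h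
  rw [← div_le_iff₀ (Real.rpow_pos_of_pos (by linarith) _)]
  apply le_csSup
  · refine ⟨C, ?_⟩
    rintro s ⟨t, ht, u, hu, htu, rfl⟩
    rw [div_le_iff₀ (Real.rpow_pos_of_pos (by linarith) _)]
    exact h2 t ht u hu htu
  · exact ⟨t, ht, u, hu, htu, by simp⟩

lemma hol_succ_intro {a b α : ℝ} (hab : a < b) {n : ℕ} {x x' : ℝ → ℂ} {M : ℝ} (hM0 : 0 ≤ M)
    (hM : ∀ t ∈ Set.Icc a b, ‖x t‖ ≤ M)
    (hd : ∀ t ∈ Set.Icc a b, HasDerivWithinAt x (x' t) (Set.Icc a b) t)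
    (hx' : HolMem a b n α x') :
    HolMem a b (n + 1) α x ∧ holNorm a b (n + 1) α x ≤ M + holNorm a b n α x' := by
  have he : Set.EqOn (derivWithin x (Set.Icc a b)) x' (Set.Icc a b) := fun t ht =>
    (hd t ht).derivWithin (uniqueDiffOn_Icc hab t ht)
  constructor
  · rw [holMem_succ hab]
    exact ⟨fun t ht => (hd t ht).differentiableWithinAt, hx'.congr he⟩
  · rw [holNorm_succ, holNorm_congr he]
    gcongr
    exact supN_le hM0 hM

lemma hol_succ_elim {a b α : ℝ} (hab : a < b) {n : ℕ} {x : ℝ → ℂ} (h : HolMem a b (n + 1) α x) :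
    ∃ M : ℝ, ∃ x' : ℝ → ℂ, 0 ≤ M ∧ (∀ t ∈ Set.Icc a b, ‖x t‖ ≤ M) ∧
    (∀ t ∈ Set.Icc a b, HasDerivWithinAt x (x' t) (Set.Icc a b) t) ∧
    HolMem a b n α x' ∧ holNorm a b (n + 1) α x = M + holNorm a b n α x' := by
  have h' := (holMem_succ hab n α x).1 h
  exact ⟨supN a b x, derivWithin x (Set.Icc a b), supN_nonneg _ _ _,
    fun t ht => le_supN h.continuousOn ht, fun t ht => (h'.1 t ht).hasDerivWithinAt, h'.2,
    holNorm_succ _ _ _ _ _⟩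

lemma hol_norm_le {a b α : ℝ} (hab : a < b) {n : ℕ} {x : ℝ → ℂ} (h : HolMem a b n α x)
    {t : ℝ} (ht : t ∈ Set.Icc a b) : ‖x t‖ ≤ holNorm a b n α x := by
  cases n with
  | zero =>
    obtain ⟨M, S, h1, h2, h3, h4, h5⟩ := hol_zero_elim h
    linarith [h4 t ht]
  | succ n =>
    obtain ⟨M, x', h1, h2, h3, h4, h5⟩ := hol_succ_elim hab h
    linarith [h2 t ht, holNorm_nonneg a b n α x']

lemma hol_add {a b α : ℝ} (hab : a < b) (hα : 0 < α) {n : ℕ} : ∀ {x y : ℝ → ℂ},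
    HolMem a b n α x → HolMem a b n α y →
    HolMem a b n α (fun t => x t + y t) ∧
      holNorm a b n α (fun t => x t + y t) ≤ holNorm a b n α x + holNorm a b n α y := by
  induction n with
  | zero =>
    intro x y hx hy
    obtain ⟨M, S, h1, h2, h3, h4, h5⟩ := hol_zero_elim hx
    obtain ⟨M', S', h1', h2', h3', h4', h5'⟩ := hol_zero_elim hy
    have := hol_zero_intro (x := fun t => x t + y t) hα (add_nonneg h1 h1') (add_nonneg h2 h2')
      (fun t ht => (norm_add_le _ _).trans (add_le_add (h4 t ht) (h4' t ht)))
      (fun t ht u hu htu => by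
        rw [add_sub_add_comm, add_mul]
        exact (norm_add_le _ _).trans (add_le_add (h5 t ht u hu htu) (h5' t ht u hu htu)))
    exact ⟨this.1, by linarith [this.2]⟩
  | succ n ih =>
    intro x y hx hy
    obtain ⟨M, x', h1, h2, h3, h4, h5⟩ := hol_succ_elim hab hx
    obtain ⟨M', y', h1', h2', h3', h4', h5'⟩ := hol_succ_elim hab hy
    have := hol_succ_intro (x := fun t => x t + y t) hab (add_nonneg h1 h1')
      (fun t ht => (norm_add_le _ _).trans (add_le_add (h2 t ht) (h2' t ht)))
      (fun t ht => (h3 t ht).add (h3' t ht)) (ih h4 h4').1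
    exact ⟨this.1, by linarith [this.2, (ih h4 h4').2]⟩

lemma hol_smul {a b α : ℝ} (hab : a < b) (hα : 0 < α) {n : ℕ} (c : ℂ) : ∀ {x : ℝ → ℂ},
    HolMem a b n α x →
    HolMem a b n α (fun t => c * x t) ∧
      holNorm a b n α (fun t => c * x t) ≤ ‖c‖ * holNorm a b n α x := by
  induction n with
  | zero =>
    intro x hx
    obtain ⟨M, S, h1, h2, h3, h4, h5⟩ := hol_zero_elim hx
    have := hol_zero_intro (x := fun t => c * x t) hα (mul_nonneg (norm_nonneg c) h1)
      (mul_nonneg (norm_nonneg c) h2)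
      (fun t ht => by rw [norm_mul]; gcongr; exact h4 t ht)
      (fun t ht u hu htu => by
        rw [← mul_sub, norm_mul, mul_assoc]; gcongr; exact h5 t ht u hu htu)
    exact ⟨this.1, by rw [h3]; linarith [this.2]⟩
  | succ n ih =>
    intro x hx
    obtain ⟨M, x', h1, h2, h3, h4, h5⟩ := hol_succ_elim hab hx
    have := hol_succ_intro (x := fun t => c * x t) hab (mul_nonneg (norm_nonneg c) h1)
      (fun t ht => by rw [norm_mul]; gcongr; exact h2 t ht)
      (fun t ht => (h3 t ht).const_mul c) (ih h4).1
    exact ⟨this.1, by rw [h5]; linarith [this.2, (ih h4).2]⟩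

lemma hol_zero {a b α : ℝ} (hab : a < b) (hα : 0 < α) {n : ℕ} :
    HolMem a b n α (fun _ => (0 : ℂ)) ∧ holNorm a b n α (fun _ => (0 : ℂ)) = 0 := by
  have key : HolMem a b n α (fun _ => (0 : ℂ)) ∧ holNorm a b n α (fun _ => (0 : ℂ)) ≤ 0 := by
    induction n with
    | zero =>
      have := hol_zero_intro (a := a) (b := b) (x := fun _ => (0 : ℂ)) (M := 0) (S := 0) hα le_rfl
        le_rfl (by simp) (by simp)
      simpa using this
    | succ n ih =>
      have := hol_succ_intro (x := fun _ => (0 : ℂ)) hab (le_refl 0) (by simp)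
        (fun t ht => hasDerivWithinAt_const t _ (0 : ℂ)) ih.1
      exact ⟨this.1, by linarith [this.2, ih.2]⟩
  exact ⟨key.1, le_antisymm key.2 (holNorm_nonneg _ _ _ _ _)⟩

lemma hol_sub {a b α : ℝ} (hab : a < b) (hα : 0 < α) {n : ℕ} {x y : ℝ → ℂ}
    (hx : HolMem a b n α x) (hy : HolMem a b n α y) :
    HolMem a b n α (fun t => x t - y t) ∧
      holNorm a b n α (fun t => x t - y t) ≤ holNorm a b n α x + holNorm a b n α y := by
  have h1 := hol_smul hab hα (-1) hy
  have h2 := hol_add hab hα hx h1.1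
  simp only [neg_mul, one_mul, ← sub_eq_add_neg, norm_neg, norm_one] at h1 h2
  exact ⟨h2.1, by linarith [h1.2, h2.2]⟩

lemma hol_sum {a b α : ℝ} (hab : a < b) (hα : 0 < α) {n : ℕ} {ι : Type*} (s : Finset ι)
    (x : ι → ℝ → ℂ) (hx : ∀ i ∈ s, HolMem a b n α (x i)) :
    HolMem a b n α (fun t => ∑ i ∈ s, x i t) ∧
      holNorm a b n α (fun t => ∑ i ∈ s, x i t) ≤ ∑ i ∈ s, holNorm a b n α (x i) := by
  classical
  induction s using Finset.induction_on with
  | empty => simpa using ⟨(hol_zero hab hα).1, (hol_zero (n := n) hab hα).2.le⟩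
  | insert i s hi ih =>
    have ih' := ih (fun j hj => hx j (Finset.mem_insert_of_mem hj))
    have := hol_add hab hα (hx i (Finset.mem_insert_self _ _)) ih'.1
    simp only [Finset.sum_insert hi]
    exact ⟨this.1, by linarith [this.2, ih'.2]⟩

/-- Embedding `C^{n+1,α} ⊂ C^{n,α}`. -/
lemma hol_embed {a b α : ℝ} (hab : a < b) (hα : 0 < α) (hα1 : α ≤ 1) {n : ℕ} : ∀ {x : ℝ → ℂ},
    HolMem a b (n + 1) α x →
    HolMem a b n α x ∧
      holNorm a b n α x ≤ (1 + (b - a) ^ (1 - α)) * holNorm a b (n + 1) α x := by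
  have hK : 0 ≤ (b - a) ^ (1 - α) := Real.rpow_nonneg (by linarith) _
  induction n with
  | zero =>
    intro x hx
    obtain ⟨M, x', h1, h2, h3, h4, h5⟩ := hol_succ_elim hab hx
    have hN := holNorm_nonneg a b 0 α x'
    have := hol_zero_intro hα h1 (mul_nonneg hK hN) h2 (fun t ht u hu htu => by
      have := (convex_Icc a b).norm_image_sub_le_of_norm_hasDerivWithin_le h3
        (fun s hs => hol_norm_le hab h4 hs) ht hu
      refine this.trans ?_
      have hp : 0 < u - t := by linarith
      rw [Real.norm_of_nonneg hp.le]
      have e : u - t = (u - t) ^ (1 - α) * (u - t) ^ α := by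
        rw [← Real.rpow_add hp]; simp
      calc holNorm a b 0 α x' * (u - t)
          = holNorm a b 0 α x' * ((u - t) ^ (1 - α) * (u - t) ^ α) := by rw [← e]
        _ ≤ holNorm a b 0 α x' * ((b - a) ^ (1 - α) * (u - t) ^ α) := by
            have h6 : u - t ≤ b - a := by linarith [hu.2, ht.1]
            have h7 : 0 ≤ 1 - α := by linarith
            gcongr
        _ = _ := by ring)
    refine ⟨this.1, this.2.trans ?_⟩
    rw [h5]
    nlinarith [mul_nonneg hK h1]
  | succ n ih =>
    intro x hx
    obtain ⟨M, x', h1, h2, h3, h4, h5⟩ := hol_succ_elim hab hx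
    have := hol_succ_intro hab h1 h2 h3 (ih h4).1
    refine ⟨this.1, this.2.trans ?_⟩
    rw [h5]
    nlinarith [mul_nonneg hK h1, (ih h4).2]

lemma hol_mul {a b α : ℝ} (hab : a < b) (hα : 0 < α) (hα1 : α ≤ 1) (n : ℕ) :
    ∃ C : ℝ, 0 ≤ C ∧ ∀ {x y : ℝ → ℂ},
    HolMem a b n α x → HolMem a b n α y →
    HolMem a b n α (fun t => x t * y t) ∧
      holNorm a b n α (fun t => x t * y t) ≤ C * (holNorm a b n α x * holNorm a b n α y) := by
  induction n with
  | zero =>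
    refine ⟨1, zero_le_one, ?_⟩
    intro x y hx hy
    obtain ⟨M, S, h1, h2, h3, h4, h5⟩ := hol_zero_elim hx
    obtain ⟨M', S', h1', h2', h3', h4', h5'⟩ := hol_zero_elim hy
    have := hol_zero_intro (a := a) (b := b) (x := fun t => x t * y t) hα (mul_nonneg h1 h1')
      (S := M * S' + S * M') (by positivity)
      (fun t ht => by rw [norm_mul]; exact mul_le_mul (h4 t ht) (h4' t ht) (norm_nonneg _) h1)
      (fun t ht u hu htu => by
        have e : x u * y u - x t * y t = x u * (y u - y t) + (x u - x t) * y t := by ring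
        have hp : 0 ≤ (u - t) ^ α := Real.rpow_nonneg (by linarith) _
        rw [e]
        refine (norm_add_le _ _).trans ?_
        rw [norm_mul, norm_mul]
        have i1 := mul_le_mul (h4 u hu) (h5' t ht u hu htu) (norm_nonneg _) h1
        have i2 := mul_le_mul (h5 t ht u hu htu) (h4' t ht) (norm_nonneg _) (mul_nonneg h2 hp)
        linarith)
    refine ⟨this.1, this.2.trans ?_⟩
    rw [h3, h3']
    nlinarith [mul_nonneg h2 h2']
  | succ n ih =>
    obtain ⟨C, hC, ih⟩ := ih
    have hK : 0 ≤ (1 + (b - a) ^ (1 - α)) := by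
      have := Real.rpow_nonneg (x := b - a) (by linarith) (1 - α)
      linarith
    set K := 1 + (b - a) ^ (1 - α) with hKdef
    refine ⟨1 + 2 * C * K, by positivity, ?_⟩
    intro x y hx hy
    obtain ⟨M, x', h1, h2, h3, h4, h5⟩ := hol_succ_elim hab hx
    obtain ⟨M', y', h1', h2', h3', h4', h5'⟩ := hol_succ_elim hab hy
    have ex := hol_embed hab hα hα1 hx
    have ey := hol_embed hab hα hα1 hy
    have p1 := ih h4 ey.1
    have p2 := ih ex.1 h4'
    have p3 := hol_add hab hα p1.1 p2.1
    have := hol_succ_intro (x := fun t => x t * y t) hab (mul_nonneg h1 h1')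
      (fun t ht => by rw [norm_mul]; exact mul_le_mul (h2 t ht) (h2' t ht) (norm_nonneg _) h1)
      (fun t ht => (h3 t ht).mul (h3' t ht)) p3.1
    refine ⟨this.1, this.2.trans ?_⟩
    have nx := holNorm_nonneg a b (n + 1) α x
    have ny := holNorm_nonneg a b (n + 1) α y
    have nx' := holNorm_nonneg a b n α x'
    have ny' := holNorm_nonneg a b n α y'
    have q1 : holNorm a b n α x' * holNorm a b n α y ≤
        holNorm a b (n + 1) α x * (K * holNorm a b (n + 1) α y) :=
      mul_le_mul (by linarith) ey.2 (holNorm_nonneg _ _ _ _ _) nx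
    have q2 : holNorm a b n α x * holNorm a b n α y' ≤
        (K * holNorm a b (n + 1) α x) * holNorm a b (n + 1) α y :=
      mul_le_mul ex.2 (by linarith) ny' (by positivity)
    have q3 : M * M' ≤ holNorm a b (n + 1) α x * holNorm a b (n + 1) α y :=
      mul_le_mul (by linarith) (by linarith) h1' nx
    have r1 := mul_le_mul_of_nonneg_left q1 hC
    have r2 := mul_le_mul_of_nonneg_left q2 hC
    calc M * M' + holNorm a b n α (fun t => x' t * y t + x t * y' t)
        ≤ M * M' + (C * (holNorm a b n α x' * holNorm a b n α y) +
            C * (holNorm a b n α x * holNorm a b n α y')) := by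
          linarith [p3.2, p1.2, p2.2]
      _ ≤ _ := by linarith

/-- Derivatives map `C^{n+r,α}` boundedly to `C^{n,α}`. -/
lemma hol_deriv {a b α : ℝ} (hab : a < b) (hα : 0 < α) (hα1 : α ≤ 1) (n r : ℕ) :
    ∃ C : ℝ, 0 ≤ C ∧ ∀ j ≤ r, ∀ x : ℝ → ℂ, HolMem a b (n + r) α x →
      HolMem a b n α (iteratedDerivWithin j x (Set.Icc a b)) ∧
      holNorm a b n α (iteratedDerivWithin j x (Set.Icc a b)) ≤ C * holNorm a b (n + r) α x := by
  have hK : 1 ≤ (1 + (b - a) ^ (1 - α)) := by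
    have := Real.rpow_nonneg (x := b - a) (by linarith) (1 - α)
    linarith
  have hE := fun n x => hol_embed hab hα hα1 (n := n) (x := x)
  set K := 1 + (b - a) ^ (1 - α) with hKdef
  refine ⟨K ^ r, by positivity, ?_⟩
  induction r with
  | zero =>
    intro j hj x hx
    obtain rfl : j = 0 := by omega
    simpa using hx
  | succ r ih =>
    intro j hj x hx
    rw [← add_assoc] at hx ⊢
    have nn := holNorm_nonneg a b (n + r + 1) α x
    cases j with
    | zero =>
      have h1 := hE _ _ hx
      have h2 := ih 0 (by omega) x h1.1
      refine ⟨h2.1, h2.2.trans ?_⟩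
      rw [pow_succ, mul_assoc]
      gcongr
      exact h1.2
    | succ j =>
      have h1 := (holMem_succ hab _ _ _).1 hx
      have h2 := ih j (by omega) _ h1.2
      rw [iteratedDerivWithin_succ']
      refine ⟨h2.1, h2.2.trans ?_⟩
      have : holNorm a b (n + r) α (derivWithin x (Icc a b)) ≤ holNorm a b (n + r + 1) α x := by
        rw [holNorm_succ]; linarith [supN_nonneg a b x]
      have h0 := holNorm_nonneg a b (n + r) α (derivWithin x (Icc a b))
      gcongr
      omega

lemma hol_complete {a b α : ℝ} (hab : a < b) (hα : 0 < α) (n : ℕ) : ∀ x : ℕ → ℝ → ℂ,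
    (∀ k, HolMem a b n α (x k)) →
    (∀ ε > 0, ∃ N, ∀ p ≥ N, ∀ q ≥ N, holNorm a b n α (fun t => x p t - x q t) ≤ ε) →
    ∃ y, HolMem a b n α y ∧ ∀ ε > 0, ∃ N, ∀ p ≥ N,
      holNorm a b n α (fun t => x p t - y t) ≤ ε := by
  induction n with
  | zero =>
    intro x hx hc
    have hpt : ∀ t ∈ Set.Icc a b, ∃ l, Tendsto (fun k => x k t) atTop (𝓝 l) := by
      intro t ht
      apply cauchySeq_tendsto_of_complete
      rw [Metric.cauchySeq_iff]
      intro ε hε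
      obtain ⟨N, hN⟩ := hc (ε / 2) (by linarith)
      refine ⟨N, fun p hp q hq => ?_⟩
      rw [dist_eq_norm]
      have := hol_norm_le hab (hol_sub hab hα (hx p) (hx q)).1 ht
      linarith [hN p hp q hq]
    choose! y hy using hpt
    have main : ∀ ε > 0, ∃ N, ∀ p ≥ N, HolMem a b 0 α (fun t => x p t - y t) ∧
        holNorm a b 0 α (fun t => x p t - y t) ≤ ε := by
      intro ε hε
      obtain ⟨N, hN⟩ := hc (ε / 2) (by linarith)
      refine ⟨N, fun p hp => ?_⟩
      have := hol_zero_intro (a := a) (b := b) (x := fun t => x p t - y t) hα (M := ε / 2)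
        (S := ε / 2) (by linarith) (by linarith)
        (fun t ht => by
          refine le_of_tendsto ((tendsto_const_nhds.sub (hy t ht)).norm) ?_
          filter_upwards [eventually_ge_atTop N] with q hq
          have := hol_norm_le hab (hol_sub hab hα (hx p) (hx q)).1 ht
          linarith [hN p hp q hq])
        (fun t ht u hu htu => by
          refine le_of_tendsto (((tendsto_const_nhds.sub (hy u hu)).sub
            (tendsto_const_nhds.sub (hy t ht))).norm) ?_
          filter_upwards [eventually_ge_atTop N] with q hq
          obtain ⟨M, S, h1, h2, h3, h4, h5⟩ := hol_zero_elim (hol_sub hab hα (hx p) (hx q)).1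
          refine (h5 t ht u hu htu).trans ?_
          have hp' : 0 ≤ (u - t) ^ α := Real.rpow_nonneg (by linarith) _
          gcongr
          linarith [hN p hp q hq])
      exact ⟨this.1, by linarith [this.2]⟩
    refine ⟨y, ?_, fun ε hε => ?_⟩
    · obtain ⟨N, hN⟩ := main 1 one_pos
      have := (hol_sub hab hα (hx N) (hN N le_rfl).1).1
      simpa using this
    · obtain ⟨N, hN⟩ := main ε hε
      exact ⟨N, fun p hp => (hN p hp).2⟩
  | succ n ih =>
    intro x hx hc
    have hel := fun k => hol_succ_elim hab (hx k)
    choose M x' h1 h2 h3 h4 h5 using hel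
    have hd : ∀ p q, ∀ t ∈ Set.Icc a b, HasDerivWithinAt (fun t => x p t - x q t)
        (x' p t - x' q t) (Set.Icc a b) t := fun p q t ht => (h3 p t ht).sub (h3 q t ht)
    have hle : ∀ p q, holNorm a b n α (fun t => x' p t - x' q t) ≤
        holNorm a b (n + 1) α (fun t => x p t - x q t) := by
      intro p q
      rw [holNorm_succ, holNorm_congr (x := derivWithin (fun t => x p t - x q t) (Icc a b))
        (y := fun t => x' p t - x' q t)
        (fun t ht => (hd p q t ht).derivWithin (uniqueDiffOn_Icc hab t ht))]
      linarith [supN_nonneg a b (fun t => x p t - x q t)]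
    obtain ⟨g, hg, hgl⟩ := ih x' h4 (fun ε hε => by
      obtain ⟨N, hN⟩ := hc ε hε
      exact ⟨N, fun p hp q hq => (hle p q).trans (hN p hp q hq)⟩)
    have ha : a ∈ Set.Icc a b := ⟨le_rfl, hab.le⟩
    obtain ⟨l, hl⟩ : ∃ l, Tendsto (fun k => x k a) atTop (𝓝 l) := by
      apply cauchySeq_tendsto_of_complete
      rw [Metric.cauchySeq_iff]
      intro ε hε
      obtain ⟨N, hN⟩ := hc (ε / 2) (by linarith)
      refine ⟨N, fun p hp q hq => ?_⟩
      rw [dist_eq_norm]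
      have := hol_norm_le hab (hol_sub hab hα (hx p) (hx q)).1 ha
      linarith [hN p hp q hq]
    -- the primitive of the limit of the derivatives
    let G : ℝ → ℂ := Set.IccExtend hab.le ((Set.Icc a b).domRestrict g)
    have hG : Continuous G := (continuousOn_iff_continuous_domRestrict.1 hg.continuousOn).Icc_extend'
    have hGg : ∀ t ∈ Set.Icc a b, G t = g t := fun t ht => by
      simp only [G]; rw [Set.IccExtend_of_mem _ _ ht]; rfl
    let y : ℝ → ℂ := fun t => l + ∫ s in a..t, G s
    have hya : y a = l := by simp [y]
    have hyd : ∀ t ∈ Set.Icc a b, HasDerivWithinAt y (g t) (Set.Icc a b) t := by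
      intro t ht
      rw [← hGg t ht]
      exact ((hG.integral_hasStrictDerivAt a t).hasDerivAt.const_add l).hasDerivWithinAt
    have hyc : ContinuousOn y (Set.Icc a b) := fun t ht => (hyd t ht).continuousWithinAt
    have hy : HolMem a b (n + 1) α y :=
      (hol_succ_intro hab (supN_nonneg a b y) (fun t ht => le_supN hyc ht) hyd hg).1
    refine ⟨y, hy, fun ε hε => ?_⟩
    have hba : 0 < b - a := by linarith
    set δ := ε / (2 + (b - a)) with hδ
    have hδ0 : 0 < δ := by positivity
    obtain ⟨N1, hN1⟩ := hgl δ hδ0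
    obtain ⟨N2, hN2⟩ := Metric.tendsto_atTop.1 hl δ hδ0
    refine ⟨max N1 N2, fun p hp => ?_⟩
    have hn := hN1 p (le_trans (le_max_left _ _) hp)
    have hn2 := hN2 p (le_trans (le_max_right _ _) hp)
    rw [dist_eq_norm, ← hya] at hn2
    have hdd : ∀ t ∈ Set.Icc a b, HasDerivWithinAt (fun t => x p t - y t) (x' p t - g t)
        (Set.Icc a b) t := fun t ht => (h3 p t ht).sub (hyd t ht)
    have hm := (hol_sub hab hα (h4 p) hg).1
    have := hol_succ_intro (M := δ + δ * (b - a)) hab (by positivity) (fun t ht => by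
      have i1 := (convex_Icc a b).norm_image_sub_le_of_norm_hasDerivWithin_le hdd
        (fun s hs => (hol_norm_le hab hm hs).trans hn) ha ht
      have i2 : ‖t - a‖ ≤ b - a := by
        rw [Real.norm_of_nonneg (by linarith [ht.1])]; linarith [ht.2]
      have i3 : δ * ‖t - a‖ ≤ δ * (b - a) := by gcongr
      have i4 : x p t - y t = ((x p t - y t) - (x p a - y a)) + (x p a - y a) := by ring
      rw [i4]
      refine (norm_add_le _ _).trans ?_
      linarith) hdd hm
    refine this.2.trans ?_
    have e : δ * (2 + (b - a)) = ε := by rw [hδ]; field_simp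
    linarith

/-! ### Vector-valued functions and the Banach space -/

section Vec

variable {a b α : ℝ} {n m : ℕ}

lemma vHolNorm_nonneg (x : ℝ → (Fin m → ℂ)) : 0 ≤ vHolNorm a b n α x :=
  Finset.sum_nonneg fun _ _ => holNorm_nonneg _ _ _ _ _

lemma vHolMem.congr {x y : ℝ → (Fin m → ℂ)} (h : vHolMem a b n α x)
    (hxy : Set.EqOn y x (Set.Icc a b)) : vHolMem a b n α y := fun i =>
  (h i).congr fun t ht => by simp only [hxy ht]

lemma vHolNorm_congr {x y : ℝ → (Fin m → ℂ)}
    (hxy : Set.EqOn x y (Set.Icc a b)) : vHolNorm a b n α x = vHolNorm a b n α y :=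
  Finset.sum_congr rfl fun i _ => holNorm_congr fun t ht => by simp only [hxy ht]

lemma vhol_add (hab : a < b) (hα : 0 < α) {x y : ℝ → (Fin m → ℂ)} (hx : vHolMem a b n α x)
    (hy : vHolMem a b n α y) : vHolMem a b n α (fun t => x t + y t) ∧
      vHolNorm a b n α (fun t => x t + y t) ≤ vHolNorm a b n α x + vHolNorm a b n α y := by
  constructor
  · exact fun i => (hol_add hab hα (hx i) (hy i)).1
  · unfold vHolNorm
    rw [← Finset.sum_add_distrib]
    exact Finset.sum_le_sum fun i _ => (hol_add hab hα (hx i) (hy i)).2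

lemma vhol_sub (hab : a < b) (hα : 0 < α) {x y : ℝ → (Fin m → ℂ)} (hx : vHolMem a b n α x)
    (hy : vHolMem a b n α y) : vHolMem a b n α (fun t => x t - y t) ∧
      vHolNorm a b n α (fun t => x t - y t) ≤ vHolNorm a b n α x + vHolNorm a b n α y := by
  constructor
  · exact fun i => (hol_sub hab hα (hx i) (hy i)).1
  · unfold vHolNorm
    rw [← Finset.sum_add_distrib]
    exact Finset.sum_le_sum fun i _ => (hol_sub hab hα (hx i) (hy i)).2

lemma vhol_smul (hab : a < b) (hα : 0 < α) (c : ℂ) {x : ℝ → (Fin m → ℂ)}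
    (hx : vHolMem a b n α x) : vHolMem a b n α (fun t => c • x t) ∧
      vHolNorm a b n α (fun t => c • x t) ≤ ‖c‖ * vHolNorm a b n α x := by
  constructor
  · exact fun i => (hol_smul hab hα c (hx i)).1
  · unfold vHolNorm
    rw [Finset.mul_sum]
    exact Finset.sum_le_sum fun i _ => (hol_smul hab hα c (hx i)).2

lemma vhol_zero (hab : a < b) (hα : 0 < α) :
    vHolMem a b n α (fun _ => (0 : Fin m → ℂ)) ∧
      vHolNorm a b n α (fun _ => (0 : Fin m → ℂ)) = 0 :=
  ⟨fun _ => (hol_zero hab hα).1, Finset.sum_eq_zero fun _ _ => (hol_zero hab hα).2⟩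

lemma vhol_norm_le (hab : a < b) {x : ℝ → (Fin m → ℂ)} (h : vHolMem a b n α x)
    {t : ℝ} (ht : t ∈ Set.Icc a b) (i : Fin m) : ‖x t i‖ ≤ vHolNorm a b n α x :=
  (hol_norm_le hab (h i) ht).trans
    (Finset.single_le_sum (f := fun i => holNorm a b n α (fun t => x t i))
      (fun _ _ => holNorm_nonneg _ _ _ _ _) (Finset.mem_univ i))

/-- Hölder vector functions vanishing outside `[a,b]`. -/
def HolSub (hab : a < b) (hα : 0 < α) (n m : ℕ) : Submodule ℂ (ℝ → (Fin m → ℂ)) where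
  carrier := { x | vHolMem a b n α x ∧ ∀ t, t ∉ Set.Icc a b → x t = 0 }
  add_mem' := by
    rintro x y ⟨hx, hx'⟩ ⟨hy, hy'⟩
    exact ⟨(vhol_add hab hα hx hy).1, fun t ht => by simp [hx' t ht, hy' t ht]⟩
  zero_mem' := ⟨(vhol_zero hab hα).1, fun t _ => rfl⟩
  smul_mem' := by
    rintro c x ⟨hx, hx'⟩
    exact ⟨(vhol_smul hab hα c hx).1, fun t ht => by simp [hx' t ht]⟩

/-- The Banach space `(C^{n,α})^m`. -/
def HV (hab : a < b) (hα : 0 < α) (n m : ℕ) : Type := HolSub hab hα n m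

variable {hab : a < b} {hα : 0 < α}

instance : AddCommGroup (HV hab hα n m) := inferInstanceAs (AddCommGroup (HolSub hab hα n m))
instance : Module ℂ (HV hab hα n m) := inferInstanceAs (Module ℂ (HolSub hab hα n m))
instance : Norm (HV hab hα n m) := ⟨fun x => vHolNorm a b n α x.1⟩

/-- The inclusion into all functions. -/
def HV.incl (hab : a < b) (hα : 0 < α) (n m : ℕ) : HV hab hα n m →ₗ[ℂ] (ℝ → (Fin m → ℂ)) :=
  (HolSub hab hα n m).subtype

lemma HV.norm_def (x : HV hab hα n m) : ‖x‖ = vHolNorm a b n α (HV.incl hab hα n m x) := rfl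

lemma HV.mem (x : HV hab hα n m) : vHolMem a b n α (HV.incl hab hα n m x) := x.2.1

lemma HV.out (x : HV hab hα n m) {t : ℝ} (ht : t ∉ Set.Icc a b) : HV.incl hab hα n m x t = 0 :=
  x.2.2 t ht

lemma HV.ext' {x y : HV hab hα n m}
    (h : Set.EqOn (HV.incl hab hα n m x) (HV.incl hab hα n m y) (Set.Icc a b)) : x = y := by
  apply Subtype.ext
  funext t
  by_cases ht : t ∈ Set.Icc a b
  · exact h ht
  · exact (x.out ht).trans (y.out ht).symm

/-- Restriction of a Hölder function to `[a,b]`. -/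
def HV.mk (hab : a < b) (hα : 0 < α) (x : ℝ → (Fin m → ℂ)) (hx : vHolMem a b n α x) :
    HV hab hα n m :=
  ⟨(Set.Icc a b).indicator x,
    hx.congr (fun _ ht => Set.indicator_of_mem ht _), fun _ ht => Set.indicator_of_notMem ht _⟩

lemma HV.mk_eqOn (x : ℝ → (Fin m → ℂ)) (hx : vHolMem a b n α x) :
    Set.EqOn (HV.incl hab hα n m (HV.mk hab hα x hx)) x (Set.Icc a b) :=
  fun _ ht => Set.indicator_of_mem ht _

lemma HV.norm_mk (x : ℝ → (Fin m → ℂ)) (hx : vHolMem a b n α x) :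
    ‖HV.mk hab hα x hx‖ = vHolNorm a b n α x :=
  vHolNorm_congr (HV.mk_eqOn (hab := hab) (hα := hα) x hx)

lemma HV.core : NormedSpace.Core ℂ (HV hab hα n m) where
  norm_nonneg x := vHolNorm_nonneg _
  norm_smul c x := by
    have h1 : ∀ (c : ℂ) (x : HV hab hα n m), ‖c • x‖ ≤ ‖c‖ * ‖x‖ := fun c x =>
      (vhol_smul hab hα c x.mem).2
    apply le_antisymm (h1 c x)
    by_cases hc : c = 0
    · subst hc
      rw [norm_zero, zero_mul]
      exact vHolNorm_nonneg _
    · have h2 := h1 c⁻¹ (c • x)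
      rw [smul_smul, inv_mul_cancel₀ hc, one_smul, norm_inv] at h2
      have hc' : 0 < ‖c‖ := norm_pos_iff.2 hc
      calc ‖c‖ * ‖x‖ ≤ ‖c‖ * (‖c‖⁻¹ * ‖c • x‖) := by gcongr
        _ = ‖c • x‖ := by field_simp
  norm_triangle x y := (vhol_add hab hα x.mem y.mem).2
  norm_eq_zero_iff x := by
    constructor
    · intro h
      apply HV.ext'
      intro t ht
      funext i
      have := vhol_norm_le hab x.mem ht i
      rw [← HV.norm_def, h] at this
      simpa using this
    · rintro rfl
      exact (vhol_zero hab hα).2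

instance : NormedAddCommGroup (HV hab hα n m) := NormedAddCommGroup.ofCore HV.core
instance : NormedSpace ℂ (HV hab hα n m) := NormedSpace.ofCore HV.core

instance : CompleteSpace (HV hab hα n m) := by
  apply Metric.complete_of_cauchySeq_tendsto
  intro u hu
  have hcomp : ∀ i : Fin m, ∃ y, HolMem a b n α y ∧ ∀ ε > 0, ∃ N, ∀ p ≥ N,
      holNorm a b n α (fun t => HV.incl hab hα n m (u p) t i - y t) ≤ ε := by
    intro i
    apply hol_complete hab hα n (fun k t => HV.incl hab hα n m (u k) t i) (fun k => (u k).mem i)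
    intro ε hε
    obtain ⟨N, hN⟩ := Metric.cauchySeq_iff.1 hu ε hε
    refine ⟨N, fun p hp q hq => ?_⟩
    have h1 := hN p hp q hq
    rw [dist_eq_norm, HV.norm_def] at h1
    refine le_trans ?_ h1.le
    exact Finset.single_le_sum
      (f := fun i => holNorm a b n α (fun t => HV.incl hab hα n m (u p - u q) t i))
      (fun _ _ => holNorm_nonneg _ _ _ _ _) (Finset.mem_univ i)
  choose y hy hlim using hcomp
  have hmem : vHolMem a b n α (fun t i => y i t) := fun i => hy i
  refine ⟨HV.mk hab hα (fun t i => y i t) hmem, ?_⟩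
  rw [Metric.tendsto_atTop]
  intro ε hε
  have hm : (0 : ℝ) < m + 1 := by positivity
  choose N hN using fun i => hlim i (ε / (m + 1)) (by positivity)
  refine ⟨Finset.univ.sup N, fun p hp => ?_⟩
  rw [dist_eq_norm, HV.norm_def]
  have e : vHolNorm a b n α (HV.incl hab hα n m (u p - HV.mk hab hα (fun t i => y i t) hmem)) =
      vHolNorm a b n α (fun t i => HV.incl hab hα n m (u p) t i - y i t) := by
    apply vHolNorm_congr
    intro t ht
    rw [map_sub, Pi.sub_apply, HV.mk_eqOn _ _ ht]
    rfl
  rw [e]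
  calc vHolNorm a b n α (fun t i => HV.incl hab hα n m (u p) t i - y i t)
      ≤ ∑ _i : Fin m, ε / (m + 1) := by
        apply Finset.sum_le_sum
        intro i _
        exact hN i p (le_trans (Finset.le_sup (Finset.mem_univ i)) hp)
    _ = m * (ε / (m + 1)) := by simp
    _ < ε := by
        rw [mul_div_assoc', div_lt_iff₀ hm]
        nlinarith

/-! ### The differential operator -/

/-- The lower order part of `Lop`. -/
def Lsum (a b : ℝ) (r : ℕ) {m : ℕ} (A : Fin r → ℝ → Matrix (Fin m) (Fin m) ℂ)
    (y : ℝ → (Fin m → ℂ)) : ℝ → (Fin m → ℂ) :=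
  fun t => ∑ j : Fin r, (A j t).mulVec (vDeriv a b (j : ℕ) y t)

lemma vderiv_bound (hab : a < b) (hα : 0 < α) (hα1 : α ≤ 1) (n r m : ℕ) :
    ∃ C : ℝ, 0 ≤ C ∧ ∀ z : ℝ → (Fin m → ℂ), vHolMem a b (n + r) α z →
      vHolMem a b n α (vDeriv a b r z) ∧
      vHolNorm a b n α (vDeriv a b r z) ≤ C * vHolNorm a b (n + r) α z := by
  obtain ⟨C, hC, h⟩ := hol_deriv hab hα hα1 n r
  refine ⟨C, hC, fun z hz => ⟨fun i => (h r le_rfl _ (hz i)).1, ?_⟩⟩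
  unfold vHolNorm
  rw [Finset.mul_sum]
  exact Finset.sum_le_sum fun i _ => (h r le_rfl _ (hz i)).2

lemma lsum_bound (hab : a < b) (hα : 0 < α) (hα1 : α ≤ 1) (n r m : ℕ) :
    ∃ C : ℝ, 0 ≤ C ∧ ∀ (A : Fin r → ℝ → Matrix (Fin m) (Fin m) ℂ) (z : ℝ → (Fin m → ℂ)),
      (∀ j, mHolMem a b n α (A j)) → vHolMem a b (n + r) α z →
      vHolMem a b n α (Lsum a b r A z) ∧
      vHolNorm a b n α (Lsum a b r A z) ≤
        C * (∑ j, mHolNorm a b n α (A j)) * vHolNorm a b (n + r) α z := by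
  obtain ⟨C, hC, h⟩ := hol_deriv hab hα hα1 n r
  obtain ⟨C', hC', h'⟩ := hol_mul hab hα hα1 n
  refine ⟨C' * C, by positivity, fun A z hA hz => ?_⟩
  have hform : ∀ i, (fun t => Lsum a b r A z t i) = fun t => ∑ j : Fin r, ∑ k : Fin m,
      A j t i k * iteratedDerivWithin j (fun s => z s k) (Set.Icc a b) t := by
    intro i
    funext t
    simp [Lsum, Matrix.mulVec, dotProduct, vDeriv]
  have hd := fun (j : Fin r) k => h j j.2.le _ (hz k)
  have hp := fun (j : Fin r) i k => h' (hA j i k) (hd j k).1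
  have hs1 := fun i (j : Fin r) => hol_sum hab hα (Finset.univ : Finset (Fin m))
    (fun k t => A j t i k * iteratedDerivWithin j (fun s => z s k) (Set.Icc a b) t)
    (fun k _ => (hp j i k).1)
  have hs2 := fun i => hol_sum hab hα (Finset.univ : Finset (Fin r))
    (fun j t => ∑ k, A j t i k * iteratedDerivWithin j (fun s => z s k) (Set.Icc a b) t)
    (fun j _ => (hs1 i j).1)
  refine ⟨fun i => by rw [hform i]; exact (hs2 i).1, ?_⟩
  have hz0 := vHolNorm_nonneg (a := a) (b := b) (n := n + r) (α := α) z
  calc vHolNorm a b n α (Lsum a b r A z)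
      ≤ ∑ i : Fin m, ∑ j : Fin r, ∑ k : Fin m,
          C' * C * holNorm a b n α (fun t => A j t i k) * vHolNorm a b (n + r) α z := by
        unfold vHolNorm
        apply Finset.sum_le_sum; intro i _
        rw [hform i]
        refine (hs2 i).2.trans ?_
        apply Finset.sum_le_sum; intro j _
        refine (hs1 i j).2.trans ?_
        apply Finset.sum_le_sum; intro k _
        refine (hp j i k).2.trans ?_
        have hk : holNorm a b (n + r) α (fun s => z s k) ≤ vHolNorm a b (n + r) α z :=
          Finset.single_le_sum (f := fun k => holNorm a b (n + r) α (fun s => z s k))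
            (fun _ _ => holNorm_nonneg _ _ _ _ _) (Finset.mem_univ k)
        have h0 := holNorm_nonneg a b n α (fun t => A j t i k)
        calc _ ≤ C' * (holNorm a b n α (fun t => A j t i k) *
              (C * vHolNorm a b (n + r) α z)) := by
              gcongr
              exact (hd j k).2.trans (by gcongr)
          _ = _ := by unfold vHolNorm; ring
    _ = C' * C * (∑ j, mHolNorm a b n α (A j)) * vHolNorm a b (n + r) α z := by
        rw [Finset.sum_comm]
        unfold mHolNorm
        simp only [Finset.mul_sum, Finset.sum_mul]

lemma lop_eq (r : ℕ) (A : Fin r → ℝ → Matrix (Fin m) (Fin m) ℂ) (z : ℝ → (Fin m → ℂ)) :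
    Lop a b r A z = fun t => vDeriv a b r z t + Lsum a b r A z t := rfl

lemma vderiv_add (hab : a < b) {N p : ℕ} (hp : p ≤ N) {x y : ℝ → (Fin m → ℂ)}
    (hx : vHolMem a b N α x) (hy : vHolMem a b N α y) {t : ℝ} (ht : t ∈ Set.Icc a b) :
    vDeriv a b p (fun s => x s + y s) t = vDeriv a b p x t + vDeriv a b p y t := by
  funext i
  exact iteratedDerivWithin_fun_add ht (uniqueDiffOn_Icc hab)
    (((hx i).1 t ht).of_le (by exact_mod_cast hp)) (((hy i).1 t ht).of_le (by exact_mod_cast hp))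

lemma vderiv_smul (hab : a < b) {N p : ℕ} (hp : p ≤ N) (c : ℂ) {x : ℝ → (Fin m → ℂ)}
    (hx : vHolMem a b N α x) {t : ℝ} (ht : t ∈ Set.Icc a b) :
    vDeriv a b p (fun s => c • x s) t = c • vDeriv a b p x t := by
  funext i
  exact iteratedDerivWithin_const_mul ht (uniqueDiffOn_Icc hab) c
    (((hx i).1 t ht).of_le (by exact_mod_cast hp))

lemma lop_add (hab : a < b) {n r : ℕ} (A : Fin r → ℝ → Matrix (Fin m) (Fin m) ℂ)
    {x y : ℝ → (Fin m → ℂ)} (hx : vHolMem a b (n + r) α x) (hy : vHolMem a b (n + r) α y)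
    {t : ℝ} (ht : t ∈ Set.Icc a b) :
    Lop a b r A (fun s => x s + y s) t = Lop a b r A x t + Lop a b r A y t := by
  unfold Lop
  rw [vderiv_add hab (by omega) hx hy ht]
  have : ∀ j : Fin r, (A j t).mulVec (vDeriv a b j (fun s => x s + y s) t) =
      (A j t).mulVec (vDeriv a b j x t) + (A j t).mulVec (vDeriv a b j y t) := by
    intro j
    rw [vderiv_add hab (by omega) hx hy ht, Matrix.mulVec_add]
  simp only [this, Finset.sum_add_distrib]
  abel

lemma lop_smul (hab : a < b) {n r : ℕ} (A : Fin r → ℝ → Matrix (Fin m) (Fin m) ℂ) (c : ℂ)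
    {x : ℝ → (Fin m → ℂ)} (hx : vHolMem a b (n + r) α x)
    {t : ℝ} (ht : t ∈ Set.Icc a b) :
    Lop a b r A (fun s => c • x s) t = c • Lop a b r A x t := by
  unfold Lop
  rw [vderiv_smul hab (by omega) c hx ht]
  have : ∀ j : Fin r, (A j t).mulVec (vDeriv a b j (fun s => c • x s) t) =
      c • (A j t).mulVec (vDeriv a b j x t) := by
    intro j
    rw [vderiv_smul hab (by omega) c hx ht, Matrix.mulVec_smul]
  simp only [this, ← Finset.smul_sum, smul_add]

lemma lop_congr {r : ℕ} (A : Fin r → ℝ → Matrix (Fin m) (Fin m) ℂ)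
    {x y : ℝ → (Fin m → ℂ)} (h : Set.EqOn x y (Set.Icc a b)) :
    Set.EqOn (Lop a b r A x) (Lop a b r A y) (Set.Icc a b) := by
  have hd : ∀ p, ∀ t ∈ Set.Icc a b, vDeriv a b p x t = vDeriv a b p y t := by
    intro p t ht
    funext i
    exact iteratedDerivWithin_congr (fun s hs => by simp only [h hs]) ht
  intro t ht
  unfold Lop
  simp only [hd _ t ht]

/-- The bounded operator `L : (C^{n+r,α})^m → (C^{n,α})^m`. -/
lemma exists_L (hab : a < b) (hα : 0 < α) (hα1 : α ≤ 1) {n r m : ℕ}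
    (A : Fin r → ℝ → Matrix (Fin m) (Fin m) ℂ) (hA : ∀ j, mHolMem a b n α (A j)) :
    ∃ L : HV hab hα (n + r) m →L[ℂ] HV hab hα n m, ∀ z,
      Set.EqOn (HV.incl hab hα n m (L z)) (Lop a b r A (HV.incl hab hα (n + r) m z))
        (Set.Icc a b) := by
  obtain ⟨C1, hC1, h1⟩ := vderiv_bound hab hα hα1 n r m
  obtain ⟨C2, hC2, h2⟩ := lsum_bound hab hα hα1 n r m
  have hmem : ∀ z : HV hab hα (n + r) m,
      vHolMem a b n α (Lop a b r A (HV.incl hab hα (n + r) m z)) := fun z =>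
    (vhol_add hab hα (h1 _ z.mem).1 (h2 A _ hA z.mem).1).1
  let L : HV hab hα (n + r) m →ₗ[ℂ] HV hab hα n m :=
    { toFun := fun z => HV.mk hab hα _ (hmem z)
      map_add' := by
        intro x y
        apply HV.ext'
        intro t ht
        rw [HV.mk_eqOn _ _ ht, map_add, map_add, Pi.add_apply, HV.mk_eqOn _ _ ht,
          HV.mk_eqOn _ _ ht]
        exact lop_add hab A x.mem y.mem ht
      map_smul' := by
        intro c x
        apply HV.ext'
        intro t ht
        rw [HV.mk_eqOn _ _ ht, map_smul, RingHom.id_apply, map_smul, Pi.smul_apply,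
          HV.mk_eqOn _ _ ht]
        exact lop_smul hab A c x.mem ht }
  refine ⟨L.mkContinuous (C1 + C2 * ∑ j, mHolNorm a b n α (A j)) ?_, fun z => HV.mk_eqOn _ (hmem z)⟩
  intro z
  change ‖HV.mk hab hα _ (hmem z)‖ ≤ _
  rw [HV.norm_mk, HV.norm_def, add_mul]
  exact (vhol_add hab hα (h1 _ z.mem).1 (h2 A _ hA z.mem).1).2.trans
    (add_le_add (h1 _ z.mem).2 (h2 A _ hA z.mem).2)

end Vec

/-! ### Abstract functional-analytic part -/

lemma eventually_bounded {X F : Type*} [NormedAddCommGroup X] [NormedSpace ℂ X] [CompleteSpace X]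
    [NormedAddCommGroup F] [NormedSpace ℂ F] (B : ℝ → X →L[ℂ] F)
    (hB : ∀ x, Tendsto (fun ε => B ε x) (𝓝[>] 0) (𝓝 (B 0 x))) :
    ∃ K : ℝ, 0 ≤ K ∧ ∀ᶠ ε in 𝓝[>] (0 : ℝ), ‖B ε‖ ≤ K := by
  by_contra! hcon
  have hex : ∀ k : ℕ, ∃ ε : ℝ, 0 < ε ∧ ε < 1 / ((k : ℝ) + 1) ∧ (k : ℝ) < ‖B ε‖ := by
    intro k
    have h1 := hcon k (Nat.cast_nonneg k)
    have h2 : ∀ᶠ ε in 𝓝[>] (0 : ℝ), ε ∈ Set.Ioo (0 : ℝ) (1 / ((k : ℝ) + 1)) :=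
      Ioo_mem_nhdsGT (by positivity)
    obtain ⟨ε, h3, h4⟩ := (h1.and_eventually h2).exists
    exact ⟨ε, h4.1, h4.2, by simpa using h3⟩
  choose e he1 he2 he3 using hex
  have hlim : Tendsto e atTop (𝓝[>] 0) := by
    rw [tendsto_nhdsWithin_iff]
    exact ⟨squeeze_zero (fun k => (he1 k).le) (fun k => (he2 k).le)
      tendsto_one_div_add_atTop_nhds_zero_nat, Eventually.of_forall he1⟩
  obtain ⟨C, hC⟩ := banach_steinhaus (g := fun k => B (e k)) (fun x => by
    obtain ⟨C, hC⟩ := ((hB x).comp hlim).norm.bddAbove_range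
    exact ⟨C, fun k => hC ⟨k, rfl⟩⟩)
  obtain ⟨k, hk⟩ := exists_nat_gt C
  linarith [hC k, he3 k]

lemma key_abstract {X Y : Type*} [NormedAddCommGroup X] [NormedSpace ℂ X] [CompleteSpace X]
    [NormedAddCommGroup Y] [NormedSpace ℂ Y] [CompleteSpace Y] {N : ℕ}
    (L : X →L[ℂ] Y) (B : ℝ → X →L[ℂ] (Fin N → ℂ))
    (hbij : Function.Bijective (L.prod (B 0)))
    (hB : ∀ x, Tendsto (fun ε => B ε x) (𝓝[>] 0) (𝓝 (B 0 x))) :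
    ∃ K C : ℝ, 0 ≤ K ∧ 0 ≤ C ∧ ∀ᶠ ε in 𝓝[>] (0 : ℝ), (∀ z, ‖B ε z‖ ≤ K * ‖z‖) ∧
      ∀ z, ‖z‖ ≤ C * (‖L z‖ + ‖B ε z‖) := by
  obtain ⟨K, hK, hKe⟩ := eventually_bounded B hB
  let S := ContinuousLinearEquiv.ofBijective (L.prod (B 0))
    (LinearMap.ker_eq_bot.2 hbij.1) (LinearMap.range_eq_top.2 hbij.2)
  let T : (Y × (Fin N → ℂ)) →L[ℂ] X := S.symm
  have hST : ∀ p, L (T p) = p.1 ∧ B 0 (T p) = p.2 := by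
    intro p
    have : (L.prod (B 0)) (T p) = p := S.apply_symm_apply p
    exact ⟨congrArg Prod.fst this, congrArg Prod.snd this⟩
  have hTS : ∀ z, T (L z, B 0 z) = z := fun z => S.symm_apply_apply z
  let E : (Fin N → ℂ) →L[ℂ] X := T.comp (ContinuousLinearMap.inr ℂ Y (Fin N → ℂ))
  have hE : ∀ q, B 0 (E q) = q := fun q => (hST (0, q)).2
  have hsum : Tendsto (fun ε => ∑ i : Fin N,
      ‖B ε (E (fun j => if i = j then 1 else 0)) - (fun j => if i = j then (1 : ℂ) else 0)‖)
      (𝓝[>] 0) (𝓝 0) := by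
    rw [show 𝓝 (0 : ℝ) = 𝓝 (∑ i : Fin N, (0 : ℝ)) by simp]
    apply tendsto_finsetSum
    intro i _
    rw [← tendsto_iff_norm_sub_tendsto_zero]
    have h := hB (E (fun j => if i = j then 1 else 0))
    rwa [hE] at h
  refine ⟨K, ‖T‖ + ‖T‖ * (2 + 2 * K * ‖T‖), hK, by positivity, ?_⟩
  filter_upwards [hKe, hsum.eventually (gt_mem_nhds (show (0 : ℝ) < 1 / 2 by norm_num))]
    with ε hε1 hε2
  have hBK : ∀ z, ‖B ε z‖ ≤ K * ‖z‖ := fun z =>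
    ((B ε).le_opNorm z).trans (by gcongr)
  refine ⟨hBK, fun z => ?_⟩
  have hq : ∀ q : Fin N → ℂ, ‖q‖ ≤ 2 * ‖B ε (E q)‖ := by
    intro q
    have h1 : B ε (E q) - q = ∑ i, q i • (B ε (E (fun j => if i = j then 1 else 0)) -
        (fun j => if i = j then (1 : ℂ) else 0)) :=
      LinearMap.pi_apply_eq_sum_univ
        (((B ε).comp E - ContinuousLinearMap.id ℂ _ :
          (Fin N → ℂ) →L[ℂ] (Fin N → ℂ)) : (Fin N → ℂ) →ₗ[ℂ] (Fin N → ℂ)) q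
    have h2 : ‖B ε (E q) - q‖ ≤ ‖q‖ * (1 / 2) := by
      rw [h1]
      refine (norm_sum_le _ _).trans ?_
      refine le_trans ?_ (mul_le_mul_of_nonneg_left hε2.le (norm_nonneg q))
      rw [Finset.mul_sum]
      apply Finset.sum_le_sum
      intro i _
      rw [norm_smul]
      gcongr
      exact norm_le_pi_norm q i
    have h3 : ‖q‖ ≤ ‖B ε (E q)‖ + ‖B ε (E q) - q‖ := by
      have := norm_sub_le (B ε (E q)) (B ε (E q) - q)
      rwa [sub_sub_cancel] at this
    linarith
  have hz : z = T (L z, 0) + E (B 0 z) := by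
    conv_lhs => rw [← hTS z]
    change _ = T (L z, 0) + T (0, B 0 z)
    rw [← map_add]
    simp
  have hw : ‖T (L z, 0)‖ ≤ ‖T‖ * ‖L z‖ := by
    refine (T.le_opNorm _).trans ?_
    simp [Prod.norm_def]
  have hEn : ∀ q, ‖E q‖ ≤ ‖T‖ * ‖q‖ := by
    intro q
    refine (T.le_opNorm (0, q)).trans ?_
    simp [Prod.norm_def]
  have hBE : ‖B ε (E (B 0 z))‖ ≤ ‖B ε z‖ + K * (‖T‖ * ‖L z‖) := by
    have e : B ε (E (B 0 z)) = B ε z - B ε (T (L z, 0)) := by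
      rw [← map_sub]
      congr 1
      exact eq_sub_of_add_eq' hz.symm
    rw [e]
    refine (norm_sub_le _ _).trans ?_
    gcongr
    exact (hBK _).trans (by gcongr)
  have hqq := (hq (B 0 z)).trans (mul_le_mul_of_nonneg_left hBE zero_le_two)
  have hT0 := norm_nonneg T
  have hL0 := norm_nonneg (L z)
  have hB0 := norm_nonneg (B ε z)
  calc ‖z‖ ≤ ‖T (L z, 0)‖ + ‖E (B 0 z)‖ := by
        conv_lhs => rw [hz]
        exact norm_add_le _ _
    _ ≤ ‖T‖ * ‖L z‖ + ‖T‖ * (2 * (‖B ε z‖ + K * (‖T‖ * ‖L z‖))) := by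
        refine add_le_add hw ((hEn _).trans ?_)
        gcongr
    _ ≤ _ := by
        have : 0 ≤ ‖T‖ * ‖B ε z‖ := by positivity
        have : 0 ≤ ‖T‖ * (2 * K * ‖T‖) * ‖B ε z‖ := by positivity
        have : 0 ≤ ‖T‖ * ‖L z‖ := by positivity
        nlinarith

/-- Theorem 1: two-sided estimate of the error of the solution via its discrepancy
`d_{n,α}(ε) = ‖L(ε)y(·,0) - f(·,ε)‖_{n,α} + |B(ε)y(·,0) - c(ε)|`. -/
theorem error_discrepancy_two_sided_estimate
    (a b : ℝ) (hab : a < b) (n : ℕ) (α : ℝ) (hα0 : 0 < α) (hα1 : α ≤ 1)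
    (m r : ℕ) (hm : 1 ≤ m) (hr : 2 ≤ r) (ε₀ : ℝ) (hε₀ : 0 < ε₀)
    (A : ℝ → Fin r → ℝ → Matrix (Fin m) (Fin m) ℂ)
    (hA : ∀ ε ∈ Set.Ico (0 : ℝ) ε₀, ∀ j, mHolMem a b n α (A ε j))
    (B : ℝ → (ℝ → (Fin m → ℂ)) →ₗ[ℂ] (Fin (r * m) → ℂ))
    (hB : ∀ ε ∈ Set.Ico (0 : ℝ) ε₀, ∃ K : ℝ, ∀ y : ℝ → (Fin m → ℂ),
      vHolMem a b (n + r) α y → ‖B ε y‖ ≤ K * vHolNorm a b (n + r) α y)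
    (hcond0 : Cond0 a b n α r m (A 0) (B 0))
    (hI : CondI a b n α r m A)
    (hII : CondII a b n α r m B)
    (ε₁ : ℝ) (hε₁0 : 0 < ε₁) (hε₁ : ε₁ < ε₀)
    (hstar : CondStar a b n α r m ε₁ A B) :
    ∃ ε₂ κ₁ κ₂ : ℝ, 0 < ε₂ ∧ ε₂ < ε₁ ∧ 0 < κ₁ ∧ 0 < κ₂ ∧
      ∀ ε ∈ Set.Ioo (0 : ℝ) ε₂,
        ∀ f₀ f : ℝ → (Fin m → ℂ), vHolMem a b n α f₀ → vHolMem a b n α f →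
        ∀ c₀ c : Fin (r * m) → ℂ, ∀ y₀ y : ℝ → (Fin m → ℂ),
          IsSol a b n α r m (A 0) (B 0) f₀ c₀ y₀ →
          IsSol a b n α r m (A ε) (B ε) f c y →
          κ₁ * (vHolNorm a b n α (fun t => Lop a b r (A ε) y₀ t - f t) + ‖B ε y₀ - c‖) ≤
              vHolNorm a b (n + r) α (fun t => y₀ t - y t) ∧
            vHolNorm a b (n + r) α (fun t => y₀ t - y t) ≤
              κ₂ * (vHolNorm a b n α (fun t => Lop a b r (A ε) y₀ t - f t) + ‖B ε y₀ - c‖) := by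
  have h00 : (0 : ℝ) ∈ Set.Ico (0 : ℝ) ε₀ := ⟨le_rfl, hε₀⟩
  obtain ⟨L, hL⟩ := exists_L hab hα0 hα1 (A 0) (hA 0 h00)
  -- the boundary operators on the Banach space
  have hBex : ∀ ε, ∃ T : HV hab hα0 (n + r) m →L[ℂ] (Fin (r * m) → ℂ),
      ε ∈ Set.Ico (0 : ℝ) ε₀ → ∀ z, T z = B ε (HV.incl hab hα0 (n + r) m z) := by
    intro ε
    by_cases hε : ε ∈ Set.Ico (0 : ℝ) ε₀
    · obtain ⟨K, hK⟩ := hB ε hε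
      exact ⟨((B ε).comp (HV.incl hab hα0 (n + r) m)).mkContinuous K (fun z => hK _ z.mem),
        fun _ z => rfl⟩
    · exact ⟨0, fun h => absurd h hε⟩
  choose T hT using hBex
  have hTlim : ∀ z, Tendsto (fun ε => T ε z) (𝓝[>] 0) (𝓝 (T 0 z)) := by
    intro z
    rw [hT 0 h00]
    refine (hII _ z.mem).congr' ?_
    filter_upwards [Ioo_mem_nhdsGT hε₀] with ε hε
    exact (hT ε ⟨hε.1.le, hε.2⟩ z).symm
  -- `B ε` only depends on the values on `[a,b]`
  have hBcongr : ∀ ε ∈ Set.Ico (0 : ℝ) ε₀, ∀ x y : ℝ → (Fin m → ℂ), vHolMem a b (n + r) α x →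
      vHolMem a b (n + r) α y → Set.EqOn x y (Set.Icc a b) → B ε x = B ε y := by
    intro ε hε x y hx hy hxy
    obtain ⟨K, hK⟩ := hB ε hε
    have h1 := hK _ (vhol_sub hab hα0 hx hy).1
    have h2 : vHolNorm a b (n + r) α (fun t => x t - y t) = 0 := by
      rw [vHolNorm_congr (y := fun _ => 0) (fun t ht => by simp [hxy ht])]
      exact (vhol_zero hab hα0).2
    rw [h2, mul_zero] at h1
    have h3 : B ε (x - y) = 0 := norm_le_zero_iff.1 h1
    rw [map_sub] at h3
    exact sub_eq_zero.1 h3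
  have hbij : Function.Bijective (L.prod (T 0)) := by
    constructor
    · rw [injective_iff_map_eq_zero]
      intro z hz
      have hz1 : L z = 0 := congrArg Prod.fst hz
      have hz2 : T 0 z = 0 := congrArg Prod.snd hz
      apply HV.ext'
      intro t ht
      refine hcond0 _ z.mem (fun s hs => ?_) ?_ t ht
      · rw [← hL z hs, hz1]; rfl
      · rw [← hT 0 h00, hz2]
    · rintro ⟨f, c⟩
      obtain ⟨y, ⟨hy1, hy2, hy3⟩, -⟩ := hstar 0 ⟨le_rfl, hε₁0⟩ _ f.mem c
      refine ⟨HV.mk hab hα0 y hy1, ?_⟩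
      have he := HV.mk_eqOn (hab := hab) (hα := hα0) y hy1
      refine Prod.ext ?_ ?_
      · apply HV.ext'
        intro t ht
        change HV.incl hab hα0 n m (L (HV.mk hab hα0 y hy1)) t = _
        rw [hL _ ht, lop_congr (A 0) he ht]
        exact hy2 t ht
      · change T 0 (HV.mk hab hα0 y hy1) = c
        rw [hT 0 h00, hBcongr 0 h00 _ _ (HV.mem _) hy1 he, hy3]
  obtain ⟨K, C, hK, hC, hev⟩ := key_abstract L T hbij hTlim
  obtain ⟨C2, hC2, hls⟩ := lsum_bound hab hα0 hα1 n r m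
  have hsum : Tendsto (fun ε => C2 * ∑ j, mHolNorm a b n α (fun t => A ε j t - A 0 j t))
      (𝓝[>] 0) (𝓝 0) := by
    have h := (tendsto_finsetSum (Finset.univ : Finset (Fin r))
      (fun j _ => hI j)).const_mul C2
    simpa using h
  have hpos : (0 : ℝ) < 1 / (2 * (C + 1)) := by positivity
  have hev2 := hsum.eventually (gt_mem_nhds hpos)
  have hall := (hev.and hev2).and (Ioo_mem_nhdsGT hε₁0)
  obtain ⟨ε₃, hε₃, hsub⟩ := (mem_nhdsGT_iff_exists_Ioo_subset).1 hall
  have hε₃0 : (0 : ℝ) < ε₃ := hε₃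
  refine ⟨min ε₃ (ε₁ / 2), 1 / (‖L‖ + 1 + K), 2 * (C + 1), lt_min hε₃0 (by linarith),
    (min_le_right _ _).trans_lt (by linarith), by positivity, by positivity, ?_⟩
  intro ε hε f₀ f hf₀ hf c₀ c y₀ y hy₀ hy
  obtain ⟨⟨⟨hTK, hTC⟩, hδ⟩, hεε⟩ := hsub ⟨hε.1, hε.2.trans_le (min_le_left _ _)⟩
  have hεI : ε ∈ Set.Ico (0 : ℝ) ε₀ := ⟨hε.1.le, hεε.2.trans hε₁⟩
  -- the difference
  have hz := (vhol_sub hab hα0 hy₀.1 hy.1).1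
  set z : ℝ → (Fin m → ℂ) := fun t => y₀ t - y t with hzdef
  let Z := HV.mk hab hα0 z hz
  have hZ : Set.EqOn (HV.incl hab hα0 (n + r) m Z) z (Set.Icc a b) := HV.mk_eqOn z hz
  have hZn : ‖Z‖ = vHolNorm a b (n + r) α z := HV.norm_mk z hz
  have hBz : B ε y₀ - c = T ε Z := by
    rw [hT ε hεI, hBcongr ε hεI _ _ (HV.mem _) hz hZ, ← hy.2.2, ← map_sub]
    rfl
  have hLz : Set.EqOn (fun t => Lop a b r (A ε) y₀ t - f t) (Lop a b r (A ε) z)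
      (Set.Icc a b) := by
    intro t ht
    have e := lop_add hab (A ε) hz hy.1 ht
    simp only [hzdef, sub_add_cancel] at e
    change Lop a b r (A ε) y₀ t - f t = _
    rw [← hy.2.1 t ht]
    exact sub_eq_of_eq_add e
  -- perturbation of the differential expression
  let D : Fin r → ℝ → Matrix (Fin m) (Fin m) ℂ := fun j t => A ε j t - A 0 j t
  have hD : ∀ j, mHolMem a b n α (D j) := fun j i k =>
    (hol_sub hab hα0 (hA ε hεI j i k) (hA 0 h00 j i k)).1
  have hDs := hls D z hD hz
  have hsplit : Set.EqOn (Lop a b r (A ε) z)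
      (fun t => HV.incl hab hα0 n m (L Z) t + Lsum a b r D z t) (Set.Icc a b) := by
    intro t ht
    change _ = HV.incl hab hα0 n m (L Z) t + Lsum a b r D z t
    rw [hL Z ht, lop_congr (A 0) hZ ht]
    simp only [Lop, Lsum, D, Matrix.sub_mulVec, Finset.sum_sub_distrib]
    abel
  have hdn : vHolNorm a b n α (fun t => Lop a b r (A ε) y₀ t - f t) =
      vHolNorm a b n α (fun t => HV.incl hab hα0 n m (L Z) t + Lsum a b r D z t) :=
    vHolNorm_congr (hLz.trans hsplit)
  have up := (vhol_add hab hα0 (L Z).mem hDs.1).2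
  have lo := (vhol_sub hab hα0 (vhol_add hab hα0 (L Z).mem hDs.1).1 hDs.1).2
  simp only [add_sub_cancel_right] at lo
  rw [← hdn, ← HV.norm_def] at up
  rw [← hdn] at lo
  change ‖L Z‖ ≤ _ at lo
  have hZ0 : 0 ≤ ‖Z‖ := norm_nonneg Z
  have hDn : vHolNorm a b n α (Lsum a b r D z) ≤ 1 / (2 * (C + 1)) * ‖Z‖ := by
    rw [hZn] at hZ0 ⊢
    exact hDs.2.trans (mul_le_mul_of_nonneg_right hδ.le hZ0)
  rw [hBz, ← hZn]
  set d := vHolNorm a b n α (fun t => Lop a b r (A ε) y₀ t - f t) with hd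
  have hLn := L.le_opNorm Z
  have hone : 1 / (2 * (C + 1)) ≤ 1 := by
    rw [div_le_one (by positivity)]; linarith
  constructor
  · rw [div_mul_eq_mul_div, one_mul, div_le_iff₀ (by positivity)]
    have := hTK Z
    have := mul_le_mul_of_nonneg_right hone hZ0
    linarith
  · have h1 := hTC Z
    have h2 : ‖L Z‖ + ‖T ε Z‖ ≤ d + ‖T ε Z‖ + 1 / (2 * (C + 1)) * ‖Z‖ := by linarith
    have h3 := h1.trans (mul_le_mul_of_nonneg_left h2 hC)
    have h4 : C * (1 / (2 * (C + 1)) * ‖Z‖) ≤ 1 / 2 * ‖Z‖ := by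
      rw [← mul_assoc]
      gcongr
      rw [mul_one_div, div_le_div_iff₀ (by positivity) (by norm_num)]
      linarith
    have h5 : 0 ≤ d + ‖T ε Z‖ := add_nonneg (vHolNorm_nonneg _) (norm_nonneg _)
    nlinarith
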